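/- Main theorem for p > N: let p > N and let Ω ⊂ ℝ^N be a bounded domain. Then there is a positive constant C(N,p), depending only on N and p, such that λ_{1,p}(Ω) ≥ C(N,p) ρ_Ω^{-p}, where ρ_Ω is the inradius of Ω. -/

import Mathlib

open MeasureTheory Metric Set

noncomputable def pEigen (N : ℕ) (p : ℝ) (Ω : Set (EuclideanSpace ℝ (Fin N))) : ℝ :=
  sInf { t | ∃ u : EuclideanSpace ℝ (Fin N) → ℝ, ContDiff ℝ (⊤ : ℕ∞) u ∧ HasCompactSupport u ∧
      tsupport u ⊆ Ω ∧ u ≠ 0 ∧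
      t = (∫ x in Ω, ‖fderiv ℝ u x‖ ^ p) / (∫ x in Ω, |u x| ^ p) }

noncomputable def inradius (N : ℕ) (Ω : Set (EuclideanSpace ℝ (Fin N))) : ℝ :=
  sSup { r | ∃ c : EuclideanSpace ℝ (Fin N), Metric.ball c r ⊆ Ω }
open scoped ENNReal

lemma aux_ftc {N : ℕ} (u : EuclideanSpace ℝ (Fin N) → ℝ) (hu : ContDiff ℝ (⊤ : ℕ∞) u)
    (x y : EuclideanSpace ℝ (Fin N)) :
    ‖u y - u x‖ₑ ≤ ‖y - x‖ₑ * ∫⁻ t in Ioc (0:ℝ) 1, ‖fderiv ℝ u (x + t • (y - x))‖ₑ := by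
  have hd : Differentiable ℝ u := hu.differentiable (by simp)
  have hc : Continuous (fderiv ℝ u) := hu.continuous_fderiv (by simp)
  have h1 : ∀ t : ℝ, HasDerivAt (fun t : ℝ => u (x + t • (y - x)))
      (fderiv ℝ u (x + t • (y - x)) (y - x)) t := by
    intro t
    have h2 : HasDerivAt (fun t : ℝ => x + t • (y - x)) (y - x) t := by
      simpa using ((hasDerivAt_id t).smul_const (y - x)).const_add x
    exact (hd _).hasFDerivAt.comp_hasDerivAt t h2
  have hcont : Continuous (fun t : ℝ => fderiv ℝ u (x + t • (y - x)) (y - x)) := by fun_prop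
  have h3 := intervalIntegral.integral_eq_sub_of_hasDerivAt (a := 0) (b := 1)
    (fun t _ => h1 t) (hcont.intervalIntegrable 0 1)
  have h4 : u y - u x = ∫ t in Ioc (0:ℝ) 1, fderiv ℝ u (x + t • (y - x)) (y - x) := by
    rw [← intervalIntegral.integral_of_le zero_le_one, h3]; simp
  rw [h4, ← lintegral_const_mul _ (by fun_prop)]
  refine (enorm_integral_le_lintegral_enorm _).trans (lintegral_mono fun t => ?_)
  rw [mul_comm]
  exact ContinuousLinearMap.le_opENorm _ _

lemma aux_pow_fin (r : ℝ) (hr : -1 < r) :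
    ∫⁻ t in Ioc (0:ℝ) 1, ENNReal.ofReal (t ^ r) < ∞ := by
  have := (intervalIntegral.intervalIntegrable_rpow' (a := 0) (b := 1) hr)
  rw [intervalIntegrable_iff_integrableOn_Ioc_of_le zero_le_one] at this
  exact this.lintegral_lt_top

lemma aux_holder (p q a : ℝ) (hpq : p.HolderConjugate q) (f : ℝ → ℝ≥0∞) (hf : Measurable f) :
    (∫⁻ t in Ioc (0:ℝ) 1, f t) ^ p ≤
      (∫⁻ t in Ioc (0:ℝ) 1, ENNReal.ofReal (t ^ (-a * q))) ^ (p / q) *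
      ∫⁻ t in Ioc (0:ℝ) 1, ENNReal.ofReal (t ^ (a * p)) * f t ^ p := by
  have hp := hpq.pos
  have hq := hpq.symm.pos
  have h := ENNReal.lintegral_mul_le_Lp_mul_Lq (volume.restrict (Ioc (0:ℝ) 1)) hpq
    (f := fun t => ENNReal.ofReal (t ^ a) * f t) (g := fun t => ENNReal.ofReal (t ^ (-a)))
    (by fun_prop) (by fun_prop)
  have e1 : ∫⁻ t in Ioc (0:ℝ) 1, f t = ∫⁻ t in Ioc (0:ℝ) 1,
      ((fun t => ENNReal.ofReal (t ^ a) * f t) * (fun t => ENNReal.ofReal (t ^ (-a)))) t := by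
    refine setLIntegral_congr_fun measurableSet_Ioc fun t ht => ?_
    have : 0 < t := ht.1
    simp only [Pi.mul_apply]
    rw [mul_right_comm, ← ENNReal.ofReal_mul (by positivity), ← Real.rpow_add this]
    simp
  have e2 : ∫⁻ t in Ioc (0:ℝ) 1, (ENNReal.ofReal (t ^ a) * f t) ^ p =
      ∫⁻ t in Ioc (0:ℝ) 1, ENNReal.ofReal (t ^ (a * p)) * f t ^ p := by
    refine setLIntegral_congr_fun measurableSet_Ioc fun t ht => ?_
    have : 0 < t := ht.1
    rw [ENNReal.mul_rpow_of_nonneg _ _ hp.le, ENNReal.ofReal_rpow_of_pos (by positivity),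
      ← Real.rpow_mul this.le]
  have e3 : ∫⁻ t in Ioc (0:ℝ) 1, (ENNReal.ofReal (t ^ (-a))) ^ q =
      ∫⁻ t in Ioc (0:ℝ) 1, ENNReal.ofReal (t ^ (-a * q)) := by
    refine setLIntegral_congr_fun measurableSet_Ioc fun t ht => ?_
    have : 0 < t := ht.1
    rw [ENNReal.ofReal_rpow_of_pos (by positivity), ← Real.rpow_mul this.le]
  rw [← e1, e2, e3] at h
  refine (ENNReal.rpow_le_rpow h hp.le).trans ?_
  rw [ENNReal.mul_rpow_of_nonneg _ _ hp.le, ← ENNReal.rpow_mul, ← ENNReal.rpow_mul,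
    one_div_mul_cancel hp.ne', ENNReal.rpow_one, mul_comm, one_div_mul_eq_div]

lemma aux_scale {N : ℕ} (g : EuclideanSpace ℝ (Fin N) → ℝ≥0∞) (hg : Measurable g)
    (x z : EuclideanSpace ℝ (Fin N)) (R : ℝ) (hx : x ∈ ball z R) (t : ℝ) (ht : t ∈ Ioc (0:ℝ) 1) :
    ∫⁻ y in ball z R, g (x + t • (y - x)) ≤
      ENNReal.ofReal (t ^ (-(N:ℝ))) * ∫⁻ y in ball z R, g y := by
  have ht0 : 0 < t := ht.1
  have hgm : Measurable ((ball z R).indicator g) := hg.indicator measurableSet_ball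
  calc ∫⁻ y in ball z R, g (x + t • (y - x))
      ≤ ∫⁻ y in ball z R, (ball z R).indicator g (x + t • (y - x)) := by
        refine setLIntegral_mono' measurableSet_ball fun y hy => ?_
        rw [indicator_of_mem]
        exact (convex_ball z R).add_smul_sub_mem hx hy ⟨ht.1.le, ht.2⟩
    _ ≤ ∫⁻ y, (ball z R).indicator g (x + t • (y - x)) := setLIntegral_le_lintegral _ _
    _ = ∫⁻ y, (ball z R).indicator g (x + t • y) :=
        lintegral_sub_right_eq_self (fun y => (ball z R).indicator g (x + t • y)) x
    _ = ∫⁻ y, (ball z R).indicator g (x + y) ∂(Measure.map (t • ·) volume) := by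
        rw [lintegral_map (by fun_prop) (by fun_prop)]
    _ = ENNReal.ofReal (t ^ (-(N:ℝ))) * ∫⁻ y, (ball z R).indicator g (x + y) := by
        rw [Measure.map_addHaar_smul _ ht0.ne', lintegral_smul_measure]
        simp only [finrank_euclideanSpace, Fintype.card_fin, smul_eq_mul]
        rw [abs_of_pos (by positivity), Real.rpow_neg ht0.le, Real.rpow_natCast]
    _ = ENNReal.ofReal (t ^ (-(N:ℝ))) * ∫⁻ y in ball z R, g y := by
        rw [lintegral_add_left_eq_self, lintegral_indicator measurableSet_ball]

lemma aux_ball {N : ℕ} (p q a : ℝ) (hpq : p.HolderConjugate q)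
    (u : EuclideanSpace ℝ (Fin N) → ℝ) (hu : ContDiff ℝ (⊤ : ℕ∞) u)
    (x z : EuclideanSpace ℝ (Fin N)) (R : ℝ) (hx : x ∈ ball z R) (hux : u x = 0) :
    ∫⁻ y in ball z R, ‖u y‖ₑ ^ p ≤ ENNReal.ofReal (2 * R) ^ p *
      ((∫⁻ t in Ioc (0:ℝ) 1, ENNReal.ofReal (t ^ (-a * q))) ^ (p / q) *
      ((∫⁻ t in Ioc (0:ℝ) 1, ENNReal.ofReal (t ^ (a * p - N))) *
        ∫⁻ y in ball z R, ‖fderiv ℝ u y‖ₑ ^ p)) := by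
  have hp := hpq.pos
  have hc : Continuous (fderiv ℝ u) := hu.continuous_fderiv (by simp)
  set M := (∫⁻ t in Ioc (0:ℝ) 1, ENNReal.ofReal (t ^ (-a * q))) ^ (p / q) with hM
  set I := ∫⁻ y in ball z R, ‖fderiv ℝ u y‖ₑ ^ p with hI
  have hpt : ∀ y ∈ ball z R, ‖u y‖ₑ ^ p ≤ ENNReal.ofReal (2 * R) ^ p * (M *
      ∫⁻ t in Ioc (0:ℝ) 1, ENNReal.ofReal (t ^ (a * p)) * ‖fderiv ℝ u (x + t • (y - x))‖ₑ ^ p) := by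
    intro y hy
    have h1 := aux_ftc u hu x y
    rw [hux, sub_zero] at h1
    have h2 : ‖y - x‖ₑ ≤ ENNReal.ofReal (2 * R) := by
      rw [← ofReal_norm]
      apply ENNReal.ofReal_le_ofReal
      rw [← dist_eq_norm]
      have := dist_triangle_right y x z
      rw [mem_ball] at hx hy
      linarith
    refine (ENNReal.rpow_le_rpow h1 hp.le).trans ?_
    rw [ENNReal.mul_rpow_of_nonneg _ _ hp.le]
    exact mul_le_mul' (ENNReal.rpow_le_rpow h2 hp.le) (aux_holder p q a hpq _ (by fun_prop))
  have hmeas : Measurable (fun w : EuclideanSpace ℝ (Fin N) × ℝ => ENNReal.ofReal (w.2 ^ (a * p)) *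
      ‖fderiv ℝ u (x + w.2 • (w.1 - x))‖ₑ ^ p) := by
    have : Continuous (fun w : EuclideanSpace ℝ (Fin N) × ℝ =>
      fderiv ℝ u (x + w.2 • (w.1 - x))) := by fun_prop
    have h3 := this.enorm.measurable
    fun_prop
  refine (setLIntegral_mono' measurableSet_ball hpt).trans ?_
  have hm2 : Measurable (fun y : EuclideanSpace ℝ (Fin N) =>
    ∫⁻ t in Ioc (0:ℝ) 1, ENNReal.ofReal (t ^ (a * p)) *
      ‖fderiv ℝ u (x + t • (y - x))‖ₑ ^ p) := hmeas.lintegral_prod_right'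
  rw [lintegral_const_mul _ (hm2.const_mul _), lintegral_const_mul _ hm2]
  gcongr
  rw [lintegral_lintegral_swap hmeas.aemeasurable, ← lintegral_mul_const _ (by fun_prop)]
  refine setLIntegral_mono' measurableSet_Ioc fun t ht => ?_
  have ht0 : 0 < t := ht.1
  have hg : Measurable (fun y => ‖fderiv ℝ u y‖ₑ ^ p) := by fun_prop
  rw [lintegral_const_mul _ (by fun_prop)]
  refine (mul_le_mul_right (aux_scale (fun y => ‖fderiv ℝ u y‖ₑ ^ p) hg x z R hx t ht) _).trans ?_
  rw [← mul_assoc, ← ENNReal.ofReal_mul (by positivity), ← Real.rpow_add ht0, ← sub_eq_add_neg]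

lemma aux_avg {N : ℕ} (f : EuclideanSpace ℝ (Fin N) → ℝ≥0∞) (hf : Measurable f) (R : ℝ) :
    ∫⁻ z, ∫⁻ y in ball z R, f y = volume (ball (0 : EuclideanSpace ℝ (Fin N)) R) * ∫⁻ y, f y := by
  have hs : MeasurableSet {w : EuclideanSpace ℝ (Fin N) × EuclideanSpace ℝ (Fin N) |
      dist w.2 w.1 < R} := measurableSet_lt (by fun_prop) (by fun_prop)
  have hm : Measurable ({w : EuclideanSpace ℝ (Fin N) × EuclideanSpace ℝ (Fin N) |
      dist w.2 w.1 < R}.indicator (fun w => f w.2)) := (hf.comp measurable_snd).indicator hs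
  calc ∫⁻ z, ∫⁻ y in ball z R, f y
      = ∫⁻ z, ∫⁻ y, {w : EuclideanSpace ℝ (Fin N) × EuclideanSpace ℝ (Fin N) |
          dist w.2 w.1 < R}.indicator (fun w => f w.2) (z, y) := by
        congr 1; ext z
        rw [← lintegral_indicator measurableSet_ball]
        rfl
    _ = ∫⁻ y, ∫⁻ z, {w : EuclideanSpace ℝ (Fin N) × EuclideanSpace ℝ (Fin N) |
          dist w.2 w.1 < R}.indicator (fun w => f w.2) (z, y) :=
        lintegral_lintegral_swap hm.aemeasurable
    _ = ∫⁻ y, volume (ball (0 : EuclideanSpace ℝ (Fin N)) R) * f y := by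
        congr 1; ext y
        have : ∀ z, {w : EuclideanSpace ℝ (Fin N) × EuclideanSpace ℝ (Fin N) |
          dist w.2 w.1 < R}.indicator (fun w => f w.2) (z, y) =
            (ball y R).indicator (fun _ => f y) z := by
          intro z
          simp [indicator, dist_comm]
        simp_rw [this]
        rw [lintegral_indicator measurableSet_ball, setLIntegral_const, mul_comm,
          Measure.addHaar_ball_center]
    _ = _ := lintegral_const_mul _ hf

lemma aux_global {N : ℕ} (p q a : ℝ) (hpq : p.HolderConjugate q)
    (u : EuclideanSpace ℝ (Fin N) → ℝ) (hu : ContDiff ℝ (⊤ : ℕ∞) u) (R : ℝ) (hR : 0 < R)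
    (hx : ∀ z, ∃ x ∈ ball z R, u x = 0) :
    ∫⁻ y, ‖u y‖ₑ ^ p ≤ ENNReal.ofReal (2 * R) ^ p *
      ((∫⁻ t in Ioc (0:ℝ) 1, ENNReal.ofReal (t ^ (-a * q))) ^ (p / q) *
      ((∫⁻ t in Ioc (0:ℝ) 1, ENNReal.ofReal (t ^ (a * p - N))))) *
        ∫⁻ y, ‖fderiv ℝ u y‖ₑ ^ p := by
  have hc : Continuous (fderiv ℝ u) := hu.continuous_fderiv (by simp)
  have hcu : Continuous u := hu.continuous
  have key : ∫⁻ z, ∫⁻ y in ball z R, ‖u y‖ₑ ^ p ≤ ∫⁻ z, (ENNReal.ofReal (2 * R) ^ p *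
      ((∫⁻ t in Ioc (0:ℝ) 1, ENNReal.ofReal (t ^ (-a * q))) ^ (p / q) *
      ((∫⁻ t in Ioc (0:ℝ) 1, ENNReal.ofReal (t ^ (a * p - N)))))) *
        ∫⁻ y in ball z R, ‖fderiv ℝ u y‖ₑ ^ p := by
    refine lintegral_mono fun z => ?_
    obtain ⟨x, hxz, hux⟩ := hx z
    refine (aux_ball p q a hpq u hu x z R hxz hux).trans (le_of_eq (by ring))
  have hm : Measurable (fun z => ∫⁻ y in ball z R, ‖fderiv ℝ u y‖ₑ ^ p) := by
    have hs : MeasurableSet {w : EuclideanSpace ℝ (Fin N) × EuclideanSpace ℝ (Fin N) |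
      dist w.2 w.1 < R} := measurableSet_lt (by fun_prop) (by fun_prop)
    have hf : Measurable (fun y => ‖fderiv ℝ u y‖ₑ ^ p) := by fun_prop
    have hm : Measurable ({w : EuclideanSpace ℝ (Fin N) × EuclideanSpace ℝ (Fin N) |
      dist w.2 w.1 < R}.indicator (fun w => ‖fderiv ℝ u w.2‖ₑ ^ p)) :=
        (hf.comp measurable_snd).indicator hs
    have h2 := hm.lintegral_prod_right' (ν := volume)
    convert h2 using 2 with z
    rw [← lintegral_indicator measurableSet_ball]
    rfl
  rw [lintegral_const_mul _ hm, aux_avg _ (by fun_prop), aux_avg _ (by fun_prop),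
    mul_left_comm] at key
  exact (ENNReal.mul_le_mul_iff_right (measure_ball_pos _ _ hR).ne' measure_ball_lt_top.ne).1 key

lemma aux_inradius {N : ℕ} (hN : 0 < N) (Ω : Set (EuclideanSpace ℝ (Fin N))) (ho : IsOpen Ω)
    (hne : Ω.Nonempty) (hb : Bornology.IsBounded Ω) :
    0 < inradius N Ω ∧ ∀ z : EuclideanSpace ℝ (Fin N), ¬ ball z (2 * inradius N Ω) ⊆ Ω := by
  have : Nonempty (Fin N) := ⟨⟨0, hN⟩⟩
  have hbdd : BddAbove { r | ∃ c : EuclideanSpace ℝ (Fin N), Metric.ball c r ⊆ Ω } := by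
    refine ⟨Metric.diam Ω, ?_⟩
    rintro r ⟨c, hc⟩
    rcases le_or_gt r 0 with h | h
    · exact h.trans Metric.diam_nonneg
    · have h1 := Metric.diam_mono hc hb
      rw [Metric.diam_ball_eq c h.le] at h1
      linarith
  obtain ⟨c, hc⟩ := hne
  obtain ⟨r, hr, hcr⟩ := Metric.isOpen_iff.1 ho c hc
  have hpos : 0 < inradius N Ω := hr.trans_le (le_csSup hbdd ⟨c, hcr⟩)
  refine ⟨hpos, fun z hz => ?_⟩
  have : 2 * inradius N Ω ≤ inradius N Ω := le_csSup hbdd ⟨z, hz⟩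
  linarith

lemma aux_bump {N : ℕ} (Ω : Set (EuclideanSpace ℝ (Fin N))) (ho : IsOpen Ω)
    (hne : Ω.Nonempty) : ∃ u : EuclideanSpace ℝ (Fin N) → ℝ, ContDiff ℝ (⊤ : ℕ∞) u ∧
      HasCompactSupport u ∧ tsupport u ⊆ Ω ∧ u ≠ 0 := by
  obtain ⟨c, hc⟩ := hne
  obtain ⟨f, h1, h2, h3, -, h4⟩ := exists_contDiff_tsupport_subset (n := (⊤ : ℕ∞)) (ho.mem_nhds hc)
  refine ⟨f, h3, h2, h1, fun h => ?_⟩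
  rw [h] at h4
  simp at h4

lemma aux_real {N : ℕ} (p : ℝ) (hp : 0 < p) (K : ℝ) (hK : 0 ≤ K)
    (Ω : Set (EuclideanSpace ℝ (Fin N)))
    (u : EuclideanSpace ℝ (Fin N) → ℝ) (hu : ContDiff ℝ (⊤ : ℕ∞) u) (hcs : HasCompactSupport u)
    (hsub : tsupport u ⊆ Ω) (hu0 : u ≠ 0)
    (h : ∫⁻ y, ‖u y‖ₑ ^ p ≤ ENNReal.ofReal K * ∫⁻ y, ‖fderiv ℝ u y‖ₑ ^ p) :
    0 < (∫ x in Ω, |u x| ^ p) ∧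
      (∫ x in Ω, |u x| ^ p) ≤ K * ∫ x in Ω, ‖fderiv ℝ u x‖ ^ p := by
  have hc : Continuous (fderiv ℝ u) := hu.continuous_fderiv (by simp)
  have hcu : Continuous u := hu.continuous
  have c1 : Continuous (fun x => |u x| ^ p) := hcu.abs.rpow_const fun _ => Or.inr hp.le
  have c2 : Continuous (fun x => ‖fderiv ℝ u x‖ ^ p) := hc.norm.rpow_const fun _ => Or.inr hp.le
  have s1 : HasCompactSupport (fun x => |u x| ^ p) :=
    hcs.comp_left (g := fun t : ℝ => |t| ^ p) (by simp [hp.ne'])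
  have s2 : HasCompactSupport (fun x => ‖fderiv ℝ u x‖ ^ p) :=
    (hcs.fderiv ℝ).comp_left (g := fun t => ‖t‖ ^ p) (by simp [hp.ne'])
  have z1 : ∫ x in Ω, |u x| ^ p = ∫ x, |u x| ^ p := by
    refine setIntegral_eq_integral_of_forall_compl_eq_zero fun x hx => ?_
    rw [image_eq_zero_of_notMem_tsupport fun hh => hx (hsub hh)]
    simp [hp.ne']
  have z2 : ∫ x in Ω, ‖fderiv ℝ u x‖ ^ p = ∫ x, ‖fderiv ℝ u x‖ ^ p := by
    refine setIntegral_eq_integral_of_forall_compl_eq_zero fun x hx => ?_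
    rw [image_eq_zero_of_notMem_tsupport fun hh => hx (hsub (tsupport_fderiv_subset ℝ hh))]
    simp [hp.ne']
  rw [z1, z2]
  have n1 : ∀ x, 0 ≤ |u x| ^ p := fun x => by positivity
  have n2 : ∀ x, 0 ≤ ‖fderiv ℝ u x‖ ^ p := fun x => by positivity
  constructor
  · obtain ⟨x, hx⟩ := Function.ne_iff.1 hu0
    refine c1.integral_pos_of_hasCompactSupport_nonneg_nonzero s1 n1 (x := x) ?_
    have : 0 < |u x| := abs_pos.2 hx
    positivity
  · have i1 := ofReal_integral_eq_lintegral_ofReal (μ := volume) (c1.integrable_of_hasCompactSupport s1)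
      (Filter.Eventually.of_forall n1)
    have i2 := ofReal_integral_eq_lintegral_ofReal (μ := volume) (c2.integrable_of_hasCompactSupport s2)
      (Filter.Eventually.of_forall n2)
    have j1 : ∫⁻ y, ‖u y‖ₑ ^ p = ∫⁻ y, ENNReal.ofReal (|u y| ^ p) := by
      congr 1; ext y
      rw [← ofReal_norm, ENNReal.ofReal_rpow_of_nonneg (norm_nonneg _) hp.le, Real.norm_eq_abs]
    have j2 : ∫⁻ y, ‖fderiv ℝ u y‖ₑ ^ p = ∫⁻ y, ENNReal.ofReal (‖fderiv ℝ u y‖ ^ p) := by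
      congr 1; ext y
      rw [← ofReal_norm, ENNReal.ofReal_rpow_of_nonneg (norm_nonneg _) hp.le]
    have hn : 0 ≤ ∫ x, ‖fderiv ℝ u x‖ ^ p := integral_nonneg n2
    rw [j1, j2, ← i1, ← i2, ← ENNReal.ofReal_mul hK,
      ENNReal.ofReal_le_ofReal_iff (by positivity)] at h
    exact h

theorem main_p_gt_N (N : ℕ) (p : ℝ) (hp : (N : ℝ) < p) :
    ∃ C : ℝ, 0 < C ∧ ∀ (Ω : Set (EuclideanSpace ℝ (Fin N))),
      IsOpen Ω → IsConnected Ω → Bornology.IsBounded Ω →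
      C * inradius N Ω ^ (-p) ≤ pEigen N p Ω := by
  rcases Nat.eq_zero_or_pos N with hN | hN
  · subst hN
    have hp0 : 0 < p := by simpa using hp
    refine ⟨1, one_pos, fun Ω ho hcon hb => ?_⟩
    have hr : inradius 0 Ω = 0 := by
      refine Real.sSup_of_not_bddAbove ?_
      rintro ⟨B, hB⟩
      obtain ⟨c, hc⟩ := hcon.nonempty
      have : B + 1 ≤ B := hB ⟨c, fun x _ => by rwa [Subsingleton.elim x c]⟩
      linarith
    rw [hr, Real.zero_rpow (by linarith), mul_zero]
    refine Real.sInf_nonneg ?_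
    rintro t ⟨u, -, -, -, -, rfl⟩
    exact div_nonneg (integral_nonneg fun x => by positivity)
      (integral_nonneg fun x => by positivity)
  · have hN1 : (1:ℝ) ≤ N := by exact_mod_cast hN
    have hp1 : 1 < p := by linarith
    have hp0 : 0 < p := by linarith
    have hpq : p.HolderConjugate p.conjExponent := Real.HolderConjugate.conjExponent hp1
    set q := p.conjExponent with hq
    have hq' : q = p / (p - 1) := rfl
    set a : ℝ := (N + p - 2) / (2 * p) with ha
    set K := (∫⁻ t in Ioc (0:ℝ) 1, ENNReal.ofReal (t ^ (-a * q))) ^ (p / q) *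
      ((∫⁻ t in Ioc (0:ℝ) 1, ENNReal.ofReal (t ^ (a * p - N)))) with hKdef
    have e1 : -1 < -a * q := by
      have hp2 : 0 < p - 1 := by linarith
      have : a * q = (N + p - 2) / (2 * (p - 1)) := by
        rw [ha, hq']; field_simp
      have : a * q < 1 := by
        rw [this, div_lt_one (by positivity)]; linarith
      linarith
    have e2 : -1 < a * p - N := by
      have : a * p = (N + p - 2) / 2 := by rw [ha]; field_simp
      rw [this]; linarith
    have hK : K ≠ ∞ := ENNReal.mul_ne_top
      (ENNReal.rpow_ne_top_of_nonneg (div_nonneg hp0.le hpq.symm.pos.le) (aux_pow_fin _ e1).ne)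
      (aux_pow_fin _ e2).ne
    refine ⟨((4:ℝ) ^ p * (K.toReal + 1))⁻¹, by positivity, fun Ω ho hcon hb => ?_⟩
    obtain ⟨hr, hball⟩ := aux_inradius hN Ω ho hcon.nonempty hb
    set ρ := inradius N Ω with hρ
    refine le_csInf ?_ ?_
    · obtain ⟨u, h1, h2, h3, h4⟩ := aux_bump Ω ho hcon.nonempty
      exact ⟨_, u, h1, h2, h3, h4, rfl⟩
    · rintro t ⟨u, h1, h2, h3, h4, rfl⟩
      have hg := aux_global p q a hpq u h1 (2 * ρ) (by positivity) (fun z => by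
        obtain ⟨x, hx, hxn⟩ := Set.not_subset.1 (hball z)
        exact ⟨x, hx, image_eq_zero_of_notMem_tsupport fun hh => hxn (h3 hh)⟩)
      rw [← hKdef] at hg
      have hle : ENNReal.ofReal (2 * (2 * ρ)) ^ p * K ≤
          ENNReal.ofReal ((4:ℝ) ^ p * (K.toReal + 1) * ρ ^ p) := by
        rw [ENNReal.ofReal_rpow_of_pos (by positivity), ← ENNReal.ofReal_toReal hK,
          ← ENNReal.ofReal_mul (by positivity)]
        apply ENNReal.ofReal_le_ofReal
        rw [show 2 * (2 * ρ) = 4 * ρ by ring, Real.mul_rpow (by norm_num) hr.le,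
          ENNReal.toReal_ofReal ENNReal.toReal_nonneg]
        have : 0 ≤ (4:ℝ) ^ p * ρ ^ p := by positivity
        nlinarith
      obtain ⟨d, hd⟩ := aux_real p hp0 ((4:ℝ) ^ p * (K.toReal + 1) * ρ ^ p) (by positivity)
        Ω u h1 h2 h3 h4 (hg.trans (mul_le_mul_left hle _))
      rw [le_div_iff₀ d, Real.rpow_neg hr.le, ← mul_inv, inv_mul_le_iff₀ (by positivity)]
      exact hd
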